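/- arXiv:2502.15982 — 2 statements merged into one kernel-verified Lean document; each statement's English description precedes it below -/
import Mathlib

section
/- Let G and H be finite undirected graphs with no isolated vertices, and let G ∇ H be their join, i.e., the disjoint union of G and H together with all edges between V(G) and V(H). Then h(G) + h(H) ≤ h(G ∇ H) ≤ min( h(G) + n(H), h(H) + n(G) ), where n(G) = |V(G)| and n(H) = |V(H)|. -/
/-- `nbhd adj A` is the set of vertices having at least one neighbor in `A`
(for the symmetric adjacency relation `adj`, which may have loops). -/
def nbhd {V : Type*} (adj : V → V → Prop) (A : Set V) : Set V :=
  {v | ∃ u ∈ A, adj u v}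

/-- Rabbit territory at (0-indexed) time `t` against the hunter strategy `W`,
when the rabbit may start anywhere in `S`.  (`terr adj S W (t-1)` is the set `R_t`
of the paper: `R_1 = S \ W_1`, `R_t = N(R_{t-1}) \ W_t`.) -/
def terr {V : Type*} (adj : V → V → Prop) (S : Set V) (W : ℕ → Set V) : ℕ → Set V
  | 0 => S \ W 0
  | t + 1 => nbhd adj (terr adj S W t) \ W (t + 1)

/-- The hunter strategy `W` uses at most `k` hunters. -/
def UsesAtMost {V : Type*} (W : ℕ → Set V) (k : ℕ) : Prop :=
  ∀ t, (W t).ncard ≤ k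

/-- The hunting number when the rabbit is restricted to start in `S`:
the least `k` for which some strategy using `k` hunters empties the territory. -/
noncomputable def huntingNumberFrom {V : Type*} (adj : V → V → Prop) (S : Set V) : ℕ :=
  sInf {k | ∃ W : ℕ → Set V, UsesAtMost W k ∧ ∃ T, terr adj S W T = ∅}

/-- The hunting number `h(G)`. -/
noncomputable def huntingNumber {V : Type*} (adj : V → V → Prop) : ℕ :=
  huntingNumberFrom adj Set.univ

/-- The hunting number with time limit `l ≥ 1`, `h(G,l)`:
the strategy `W_1, …, W_l` corresponds to indices `0, …, l-1`, and the rabbit must be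
caught by round `l`, i.e. `R_l = terr … (l-1) = ∅`. -/
noncomputable def huntingNumberTL {V : Type*} (adj : V → V → Prop) (l : ℕ) : ℕ :=
  sInf {k | ∃ W : ℕ → Set V, UsesAtMost W k ∧ terr adj Set.univ W (l - 1) = ∅}

/-- The join `G ∇ H` of two graphs: disjoint union plus all edges between the two sides. -/
def adjJoin {V U : Type*} (adjG : V → V → Prop) (adjH : U → U → Prop) :
    V ⊕ U → V ⊕ U → Prop
  | Sum.inl a, Sum.inl b => adjG a b
  | Sum.inr a, Sum.inr b => adjH a b
  | Sum.inl _, Sum.inr _ => True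
  | Sum.inr _, Sum.inl _ => True

section HuntingNumber

open Set

variable {V U : Type*}

lemma terr_congr {adj : V → V → Prop} {S : Set V} {W W' : ℕ → Set V} {t : ℕ}
    (h : ∀ i ≤ t, W i = W' i) : terr adj S W t = terr adj S W' t := by
  induction t with
  | zero => simp [terr, h 0 le_rfl]
  | succ t ih => rw [terr, terr, ih fun i hi => h i (by omega), h (t + 1) le_rfl]

lemma huntingNumber_le {adj : V → V → Prop} {k T : ℕ} {W : ℕ → Set V}
    (hW : UsesAtMost W k) (hT : terr adj univ W T = ∅) : huntingNumber adj ≤ k :=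
  Nat.sInf_le ⟨W, hW, T, hT⟩

lemma huntingNumber_le_card [Fintype V] (adj : V → V → Prop) :
    huntingNumber adj ≤ Fintype.card V :=
  huntingNumber_le (W := fun _ => univ) (T := 0)
    (fun _ => by rw [ncard_univ, Nat.card_eq_fintype_card]) (by simp [terr])

/-- On a finite graph the hunting number is attained by a winning strategy. -/
lemma exists_huntingNumber_strategy [Fintype V] (adj : V → V → Prop) :
    ∃ W : ℕ → Set V, UsesAtMost W (huntingNumber adj) ∧ ∃ T, terr adj univ W T = ∅ :=
  Nat.sInf_mem (s := {k | ∃ W : ℕ → Set V, UsesAtMost W k ∧ ∃ T, terr adj univ W T = ∅})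
    ⟨Nat.card V, fun _ => univ, fun _ => (ncard_univ V).le, 0, by simp [terr]⟩

/-- `A` is a territory that arises when fewer than `huntingNumber adj` hunters are used in
every round. -/
def IsUnderhunted (adj : V → V → Prop) (A : Set V) : Prop :=
  ∃ W : ℕ → Set V, (∀ i, (W i).ncard < huntingNumber adj) ∧ ∃ t, terr adj univ W t = A

lemma isUnderhunted_univ_diff {adj : V → V → Prop} {X : Set V}
    (hX : X.ncard < huntingNumber adj) : IsUnderhunted adj (univ \ X) :=
  ⟨fun _ => X, fun _ => hX, 0, rfl⟩

lemma IsUnderhunted.nonempty {adj : V → V → Prop} {A : Set V} (hA : IsUnderhunted adj A) :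
    A.Nonempty := by
  obtain ⟨W, hW, t, rfl⟩ := hA
  rw [nonempty_iff_ne_empty]
  intro h
  have hle := huntingNumber_le (k := huntingNumber adj - 1) (fun i => Nat.le_sub_one_of_lt (hW i)) h
  have := hW 0
  omega

lemma IsUnderhunted.nbhd_diff {adj : V → V → Prop} {A X : Set V} (hA : IsUnderhunted adj A)
    (hX : X.ncard < huntingNumber adj) : IsUnderhunted adj (nbhd adj A \ X) := by
  obtain ⟨W, hW, t, rfl⟩ := hA
  refine ⟨fun i => if i ≤ t then W i else X, fun i => ?_, t + 1, ?_⟩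
  · dsimp only
    split_ifs
    exacts [hW i, hX]
  · rw [terr, terr_congr (W' := W) fun i hi => if_pos hi]
    simp

section Join

variable {adjG : V → V → Prop} {adjH : U → U → Prop} {R : Set (V ⊕ U)}

lemma preimage_inl_nbhd_adjJoin_of_nonempty (h : (Sum.inr ⁻¹' R).Nonempty) :
    Sum.inl ⁻¹' nbhd (adjJoin adjG adjH) R = univ :=
  eq_univ_of_forall fun _ => ⟨Sum.inr h.some, h.some_mem, trivial⟩

lemma preimage_inr_nbhd_adjJoin_of_nonempty (h : (Sum.inl ⁻¹' R).Nonempty) :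
    Sum.inr ⁻¹' nbhd (adjJoin adjG adjH) R = univ :=
  eq_univ_of_forall fun _ => ⟨Sum.inl h.some, h.some_mem, trivial⟩

lemma preimage_inl_nbhd_adjJoin_of_empty (h : Sum.inr ⁻¹' R = ∅) :
    Sum.inl ⁻¹' nbhd (adjJoin adjG adjH) R = nbhd adjG (Sum.inl ⁻¹' R) := by
  have h' : ∀ u, Sum.inr u ∉ R := fun u hu => (h ▸ hu : u ∈ (∅ : Set U))
  ext v
  simp [nbhd, adjJoin, h']

lemma preimage_inr_nbhd_adjJoin_of_empty (h : Sum.inl ⁻¹' R = ∅) :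
    Sum.inr ⁻¹' nbhd (adjJoin adjG adjH) R = nbhd adjH (Sum.inr ⁻¹' R) := by
  have h' : ∀ v, Sum.inl v ∉ R := fun v hv => (h ▸ hv : v ∈ (∅ : Set V))
  ext u
  simp [nbhd, adjJoin, h']

end Join

lemma ncard_preimage_inl_add_ncard_preimage_inr [Finite V] [Finite U] (X : Set (V ⊕ U)) :
    (Sum.inl ⁻¹' X).ncard + (Sum.inr ⁻¹' X).ncard = X.ncard := by
  rw [← ncard_image_of_injective (Sum.inl ⁻¹' X) (Sum.inl_injective (β := U)),
    ← ncard_image_of_injective (Sum.inr ⁻¹' X) (Sum.inr_injective (α := V)),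
    ← ncard_union_eq, image_preimage_inl_union_image_preimage_inr]
  exact disjoint_image_inl_image_inr

lemma huntingNumber_le_ncard_of_univ_diff_eq_empty [Fintype V] {adj : V → V → Prop} {X : Set V}
    (h : univ \ X = ∅) : huntingNumber adj ≤ X.ncard := by
  rw [univ_subset_iff.mp (sdiff_eq_empty.mp h), ncard_univ, Nat.card_eq_fintype_card]
  exact huntingNumber_le_card adj

/-- One round of the game on a join, seen from one side. Here `A`, `B` are the two parts of the
territory, `A'`, `B'` the vertices of the two sides reachable from them, and `X`, `Y` the hunters
on the two sides. -/
lemma IsUnderhunted.of_join_step [Fintype V] {adjG : V → V → Prop} {adjH : U → U → Prop}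
    {A A' X : Set V} {B B' Y : Set U}
    (hXY : X.ncard + Y.ncard < huntingNumber adjG + huntingNumber adjH)
    (hA : A = ∅ → IsUnderhunted adjH B) (hB : B = ∅ → IsUnderhunted adjG A)
    (hA'₁ : B.Nonempty → A' = univ) (hA'₀ : B = ∅ → A' = nbhd adjG A)
    (hB'₁ : A.Nonempty → B' = univ) (hB'₀ : A = ∅ → B' = nbhd adjH B)
    (h : A' \ X = ∅) : IsUnderhunted adjH (B' \ Y) := by
  have hY : Y.ncard < huntingNumber adjH := by
    suffices huntingNumber adjG ≤ X.ncard by omega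
    rcases B.eq_empty_or_nonempty with hB0 | hB1
    · by_contra! hX
      have := ((hB hB0).nbhd_diff hX).nonempty
      rw [← hA'₀ hB0, h] at this
      exact not_nonempty_empty this
    · exact huntingNumber_le_ncard_of_univ_diff_eq_empty (hA'₁ hB1 ▸ h)
  rcases A.eq_empty_or_nonempty with hA0 | hA1
  · exact hB'₀ hA0 ▸ (hA hA0).nbhd_diff hY
  · exact hB'₁ hA1 ▸ isUnderhunted_univ_diff hY

lemma isUnderhunted_terr_adjJoin [Fintype V] [Fintype U] {adjG : V → V → Prop}
    {adjH : U → U → Prop} {W : ℕ → Set (V ⊕ U)}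
    (hW : ∀ t, (W t).ncard < huntingNumber adjG + huntingNumber adjH) (t : ℕ) :
    (Sum.inl ⁻¹' terr (adjJoin adjG adjH) univ W t = ∅ →
      IsUnderhunted adjH (Sum.inr ⁻¹' terr (adjJoin adjG adjH) univ W t)) ∧
    (Sum.inr ⁻¹' terr (adjJoin adjG adjH) univ W t = ∅ →
      IsUnderhunted adjG (Sum.inl ⁻¹' terr (adjJoin adjG adjH) univ W t)) := by
  simp_rw [← ncard_preimage_inl_add_ncard_preimage_inr] at hW
  induction t with
  | zero =>
    have hW0 := hW 0
    simp only [terr, preimage_sdiff, preimage_univ]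
    constructor <;> intro h <;> apply isUnderhunted_univ_diff
    · have := huntingNumber_le_ncard_of_univ_diff_eq_empty (adj := adjG) h
      omega
    · have := huntingNumber_le_ncard_of_univ_diff_eq_empty (adj := adjH) h
      omega
  | succ t ih =>
    simp only [terr, preimage_sdiff]
    exact ⟨IsUnderhunted.of_join_step (hW (t + 1)) ih.1 ih.2
        preimage_inl_nbhd_adjJoin_of_nonempty preimage_inl_nbhd_adjJoin_of_empty
        preimage_inr_nbhd_adjJoin_of_nonempty preimage_inr_nbhd_adjJoin_of_empty,
      IsUnderhunted.of_join_step (by rw [add_comm, add_comm (huntingNumber _)]; exact hW (t + 1))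
        ih.2 ih.1
        preimage_inr_nbhd_adjJoin_of_nonempty preimage_inr_nbhd_adjJoin_of_empty
        preimage_inl_nbhd_adjJoin_of_nonempty preimage_inl_nbhd_adjJoin_of_empty⟩

lemma huntingNumber_add_le_huntingNumber_adjJoin [Fintype V] [Fintype U]
    (adjG : V → V → Prop) (adjH : U → U → Prop) :
    huntingNumber adjG + huntingNumber adjH ≤ huntingNumber (adjJoin adjG adjH) := by
  by_contra! hlt
  obtain ⟨W, hW, T, hT⟩ := exists_huntingNumber_strategy (adjJoin adjG adjH)
  have := (isUnderhunted_terr_adjJoin (fun t => (hW t).trans_lt hlt) T).1 (by simp [hT])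
  simpa [hT] using this.nonempty

lemma huntingNumber_adjJoin_le_add_card_right [Fintype V] [Fintype U]
    (adjG : V → V → Prop) (adjH : U → U → Prop) :
    huntingNumber (adjJoin adjG adjH) ≤ huntingNumber adjG + Fintype.card U := by
  obtain ⟨W, hW, T, hT⟩ := exists_huntingNumber_strategy adjG
  let W' : ℕ → Set (V ⊕ U) := fun t => Sum.inl '' W t ∪ range Sum.inr
  have hl (t : ℕ) : Sum.inl ⁻¹' W' t = W t := by ext; simp [W']
  have hr (t : ℕ) : Sum.inr ⁻¹' W' t = univ := by ext; simp [W']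
  have key (t : ℕ) : Sum.inl ⁻¹' terr (adjJoin adjG adjH) univ W' t = terr adjG univ W t ∧
      Sum.inr ⁻¹' terr (adjJoin adjG adjH) univ W' t = ∅ := by
    induction t with
    | zero => simp [terr, hl, hr]
    | succ t ih =>
      simp only [terr, preimage_sdiff, hl, hr, sdiff_univ, and_true]
      rw [preimage_inl_nbhd_adjJoin_of_empty ih.2, ih.1]
  refine huntingNumber_le (W := W') (T := T) (fun t => ?_) ?_
  · rw [← ncard_preimage_inl_add_ncard_preimage_inr, hl, hr, ncard_univ, Nat.card_eq_fintype_card]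
    exact Nat.add_le_add_right (hW t) _
  · rw [← image_preimage_inl_union_image_preimage_inr (terr _ _ _ _), (key T).1, (key T).2, hT]
    simp

lemma huntingNumber_adjJoin_le_add_card_left [Fintype V] [Fintype U]
    (adjG : V → V → Prop) (adjH : U → U → Prop) :
    huntingNumber (adjJoin adjG adjH) ≤ huntingNumber adjH + Fintype.card V := by
  obtain ⟨W, hW, T, hT⟩ := exists_huntingNumber_strategy adjH
  let W' : ℕ → Set (V ⊕ U) := fun t => range Sum.inl ∪ Sum.inr '' W t
  have hl (t : ℕ) : Sum.inl ⁻¹' W' t = univ := by ext; simp [W']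
  have hr (t : ℕ) : Sum.inr ⁻¹' W' t = W t := by ext; simp [W']
  have key (t : ℕ) : Sum.inl ⁻¹' terr (adjJoin adjG adjH) univ W' t = ∅ ∧
      Sum.inr ⁻¹' terr (adjJoin adjG adjH) univ W' t = terr adjH univ W t := by
    induction t with
    | zero => simp [terr, hl, hr]
    | succ t ih =>
      simp only [terr, preimage_sdiff, hl, hr, sdiff_univ, true_and]
      rw [preimage_inr_nbhd_adjJoin_of_empty ih.1, ih.2]
  refine huntingNumber_le (W := W') (T := T) (fun t => ?_) ?_
  · rw [← ncard_preimage_inl_add_ncard_preimage_inr, hl, hr, ncard_univ, Nat.card_eq_fintype_card,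
      add_comm]
    exact Nat.add_le_add_right (hW t) _
  · rw [← image_preimage_inl_union_image_preimage_inr (terr _ _ _ _), (key T).1, (key T).2, hT]
    simp

end HuntingNumber

/-- `h(G) + h(H) ≤ h(G ∇ H) ≤ min(h(G) + n(H), h(H) + n(G))`. -/
theorem hunting_number_join_bounds {V U : Type*} [Fintype V] [Fintype U]
    (adjG : V → V → Prop) (hsymmG : Symmetric adjG) (hnisoG : ∀ v, ∃ u, adjG v u)
    (adjH : U → U → Prop) (hsymmH : Symmetric adjH) (hnisoH : ∀ v, ∃ u, adjH v u) :
    huntingNumber adjG + huntingNumber adjH ≤ huntingNumber (adjJoin adjG adjH) ∧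
    huntingNumber (adjJoin adjG adjH) ≤
      min (huntingNumber adjG + Fintype.card U) (huntingNumber adjH + Fintype.card V) := by
  exact ⟨huntingNumber_add_le_huntingNumber_adjJoin adjG adjH,
    le_min (huntingNumber_adjJoin_le_add_card_right adjG adjH)
      (huntingNumber_adjJoin_le_add_card_left adjG adjH)⟩
end

section
/- Let G = (V,E) be a finite undirected simple graph on n vertices with no isolated vertices, and let l be a positive integer. Let ca(G,l) be the minimum cardinality of a set F ⊆ V × {1,...,l} such that every walk v_1, v_2, ..., v_l in G (i.e., v_t v_{t+1} ∈ E for all 1 ≤ t ≤ l−1) satisfies (v_t, t) ∈ F for some t ∈ {1,...,l}. Then h(G,l) ≤ ca(G,l) ≤ min(l, n) · h(G,l). -/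
/-- `ca(G,l)`: the minimum cardinality of a set `F ⊆ V × {1,…,l}` of shots
(here indexed by `V × Fin l`) such that every walk `v_1, …, v_l` in `G` is hit,
i.e. `(v_t, t) ∈ F` for some `t`. -/
noncomputable def ca {V : Type*} [Fintype V] (G : SimpleGraph V) (l : ℕ) : ℕ :=
  sInf {m : ℕ | ∃ F : Finset (V × Fin l),
    (∀ v : ℕ → V, (∀ t, t + 1 < l → G.Adj (v t) (v (t + 1))) →
      ∃ t : Fin l, ((v (t : ℕ), t) ∈ F)) ∧ F.card = m}

/-- A vertex lies in the rabbit territory at time `T` iff it is the position at time `T` of a walk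
that starts in `S` and evades all shots up to time `T`. -/
theorem mem_terr_iff {V : Type*} {adj : V → V → Prop} {S : Set V} {W : ℕ → Set V} {T : ℕ} {x : V} :
    x ∈ terr adj S W T ↔ ∃ v : ℕ → V, v 0 ∈ S ∧ v T = x ∧
      (∀ t < T, adj (v t) (v (t + 1))) ∧ ∀ t ≤ T, v t ∉ W t := by
  induction T generalizing x with
  | zero =>
    constructor
    · rintro ⟨hS, hW⟩
      exact ⟨fun _ => x, hS, rfl, by simp, by simpa using hW⟩
    · rintro ⟨v, hS, rfl, -, hW⟩
      exact ⟨hS, hW 0 le_rfl⟩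
  | succ T ih =>
    constructor
    · rintro ⟨⟨u, hu, hux⟩, hx⟩
      obtain ⟨v, hS, rfl, hadj, hW⟩ := ih.1 hu
      refine ⟨fun t => if t ≤ T then v t else x, by simpa using hS, by simp, ?_, ?_⟩
      · intro t ht
        obtain h | rfl := Nat.lt_succ_iff_lt_or_eq.1 ht
        · simpa [h.le, Nat.succ_le_of_lt h] using hadj t h
        · simpa using hux
      · intro t ht
        obtain h | rfl := Nat.le_succ_iff.1 ht
        · simpa [h] using hW t h
        · simpa using hx
    · rintro ⟨v, hS, rfl, hadj, hW⟩
      exact ⟨⟨v T, ih.2 ⟨v, hS, rfl, fun t ht => hadj t (by omega), fun t ht => hW t (by omega)⟩,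
        hadj T (by omega)⟩, hW _ le_rfl⟩

/-- A strategy empties the territory by time `T` iff every walk is shot by time `T`. -/
theorem terr_univ_eq_empty_iff {V : Type*} {adj : V → V → Prop} {W : ℕ → Set V} {T : ℕ} :
    terr adj Set.univ W T = ∅ ↔
      ∀ v : ℕ → V, (∀ t < T, adj (v t) (v (t + 1))) → ∃ t ≤ T, v t ∈ W t := by
  simp only [Set.eq_empty_iff_forall_notMem, mem_terr_iff]
  constructor
  · intro h v hv
    by_contra! hW
    exact h (v T) ⟨v, trivial, rfl, hv, hW⟩
  · rintro h x ⟨v, -, -, hv, hW⟩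
    obtain ⟨t, ht, hmem⟩ := h v hv
    exact hW t ht hmem

/-- Shooting at every vertex in the first round catches the rabbit. -/
theorem ca_le_card {V : Type*} [Fintype V] (G : SimpleGraph V) {l : ℕ} (hl : 1 ≤ l) :
    ca G l ≤ Fintype.card V :=
  Nat.sInf_le ⟨Finset.univ ×ˢ {⟨0, hl⟩}, fun _ _ => ⟨⟨0, hl⟩, by simp⟩, by simp⟩

theorem exists_card_eq_ca {V : Type*} [Fintype V] (G : SimpleGraph V) {l : ℕ} (hl : 1 ≤ l) :
    ∃ F : Finset (V × Fin l),
      (∀ v : ℕ → V, (∀ t, t + 1 < l → G.Adj (v t) (v (t + 1))) →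
        ∃ t : Fin l, ((v (t : ℕ), t) ∈ F)) ∧ F.card = ca G l :=
  Nat.sInf_mem (s := {m : ℕ | ∃ F : Finset (V × Fin l),
    (∀ v : ℕ → V, (∀ t, t + 1 < l → G.Adj (v t) (v (t + 1))) →
      ∃ t : Fin l, ((v (t : ℕ), t) ∈ F)) ∧ F.card = m})
    ⟨_, Finset.univ ×ˢ {⟨0, hl⟩}, fun _ _ => ⟨⟨0, hl⟩, by simp⟩, rfl⟩

/-- A family of shots meeting every walk is a strategy using at most that many hunters. -/
theorem exists_strategy_ca {V : Type*} [Fintype V] (G : SimpleGraph V) {l : ℕ} (hl : 1 ≤ l) :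
    ∃ W : ℕ → Set V, UsesAtMost W (ca G l) ∧ terr G.Adj Set.univ W (l - 1) = ∅ := by
  obtain ⟨F, hF, hcard⟩ := exists_card_eq_ca G hl
  refine ⟨fun t => {x | ∃ h : t < l, (x, ⟨t, h⟩) ∈ F}, fun t => ?_,
    terr_univ_eq_empty_iff.2 fun v hv => ?_⟩
  · rw [← hcard, ← Set.ncard_coe_finset F]
    by_cases h : t < l
    · exact Set.ncard_le_ncard_of_injOn (fun x => (x, (⟨t, h⟩ : Fin l)))
        (fun x hx => hx.2) (fun x _ y _ hxy => congrArg Prod.fst hxy)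
    · simp [h]
  · obtain ⟨t, ht⟩ := hF v fun t ht => hv t (by omega)
    exact ⟨t, by omega, t.2, ht⟩

theorem huntingNumberTL_le_ca {V : Type*} [Fintype V] (G : SimpleGraph V) {l : ℕ} (hl : 1 ≤ l) :
    huntingNumberTL G.Adj l ≤ ca G l :=
  Nat.sInf_le (exists_strategy_ca G hl)

theorem exists_strategy_huntingNumberTL {V : Type*} [Fintype V] (G : SimpleGraph V) {l : ℕ}
    (hl : 1 ≤ l) : ∃ W : ℕ → Set V,
      UsesAtMost W (huntingNumberTL G.Adj l) ∧ terr G.Adj Set.univ W (l - 1) = ∅ :=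
  Nat.sInf_mem (s := {k | ∃ W : ℕ → Set V, UsesAtMost W k ∧ terr G.Adj Set.univ W (l - 1) = ∅})
    ⟨_, exists_strategy_ca G hl⟩

/-- A strategy with `k` hunters fires at most `l * k` shots in `l` rounds. -/
theorem ca_le_mul_huntingNumberTL {V : Type*} [Fintype V] (G : SimpleGraph V) {l : ℕ}
    (hl : 1 ≤ l) : ca G l ≤ l * huntingNumberTL G.Adj l := by
  classical
  obtain ⟨W, hW, hT⟩ := exists_strategy_huntingNumberTL G hl
  rw [terr_univ_eq_empty_iff] at hT
  let F : Finset (V × Fin l) := {p | p.1 ∈ W p.2}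
  have hF : F.card ≤ l * huntingNumberTL G.Adj l := by
    have h := Finset.card_le_mul_card_image_of_maps_to (s := F) (t := Finset.univ) (f := Prod.snd)
      (by simp) (huntingNumberTL G.Adj l) fun t _ => ?_
    · simpa [mul_comm] using h
    · rw [← Set.ncard_coe_finset]
      refine le_trans (Set.ncard_le_ncard_of_injOn Prod.fst ?_ ?_) (hW t)
      · rintro ⟨x, s⟩ hx
        simp only [F, Finset.coe_filter, Finset.mem_filter, Set.mem_ofPred_eq] at hx
        obtain ⟨⟨-, hx⟩, rfl⟩ := hx
        exact hx
      · rintro ⟨x, s⟩ hx ⟨y, r⟩ hy hxy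
        simp only [Finset.coe_filter, Set.mem_ofPred_eq] at hx hy
        exact Prod.ext hxy (hx.2.trans hy.2.symm)
  refine le_trans (Nat.sInf_le ⟨F, fun v hv => ?_, rfl⟩) hF
  obtain ⟨t, ht, hmem⟩ := hT v fun t ht => hv t (by omega)
  exact ⟨⟨t, by omega⟩, by simpa [F] using hmem⟩

/-- `h(G,l) ≤ ca(G,l) ≤ min(l,n) · h(G,l)`. -/
theorem ca_approximates_hl {V : Type*} [Fintype V]
    (G : SimpleGraph V) (hniso : ∀ v, ∃ u, G.Adj v u) (l : ℕ) (hl : 1 ≤ l) :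
    huntingNumberTL G.Adj l ≤ ca G l ∧
      ca G l ≤ min l (Fintype.card V) * huntingNumberTL G.Adj l := by
  refine ⟨huntingNumberTL_le_ca G hl, ?_⟩
  have hmul := ca_le_mul_huntingNumberTL G hl
  obtain h | h := Nat.eq_zero_or_pos (huntingNumberTL G.Adj l)
  · simpa [h] using hmul
  · rw [min_mul_of_nonneg _ _ h.le]
    exact le_min hmul ((ca_le_card G hl).trans (Nat.le_mul_of_pos_right _ h))
end
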